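/- Let P, Q ⊂ R^n be lattice polytopes with dim(P + Q) = dim(P) + dim(Q). Then there is an affine bijection from Aff(P) × Aff(Q) onto Aff(P + Q) mapping (p, q) to p + q which sends lattice points (pairs of points of the affine lattices Aff(P) ∩ Z^n and Aff(Q) ∩ Z^n) to lattice points of Aff(P + Q) ∩ Z^n, and consequently Vol(P + Q) equals Vol(P × Q) = binom(i+j, i) · Vol(P) · Vol(Q) times a nonnegative integer (the lattice index / determinant of this map), where i = dim(P), j = dim(Q). -/

import Mathlib

open Pointwise MeasureTheory

noncomputable section

/-- Standard dot product on `Fin n → ℝ`. -/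
def dotR {n : ℕ} (c x : Fin n → ℝ) : ℝ := ∑ i, c i * x i

/-- The set of minimizers of the linear functional `x ↦ cᵀx` over `P`. -/
def argminSet {n : ℕ} (c : Fin n → ℝ) (P : Set (Fin n → ℝ)) : Set (Fin n → ℝ) :=
  {x ∈ P | ∀ y ∈ P, dotR c x ≤ dotR c y}

/-- A polytope: the convex hull of a nonempty finite set of points. -/
def IsPolytope {n : ℕ} (P : Set (Fin n → ℝ)) : Prop :=
  ∃ V : Finset (Fin n → ℝ), V.Nonempty ∧ P = convexHull ℝ (V : Set (Fin n → ℝ))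

/-- A lattice polytope: the convex hull of a nonempty finite set of integral points. -/
def IsLatticePolytope {n : ℕ} (P : Set (Fin n → ℝ)) : Prop :=
  ∃ V : Finset (Fin n → ℤ), V.Nonempty ∧
    P = convexHull ℝ ((fun v (i : Fin n) => ((v i : ℤ) : ℝ)) '' (V : Set (Fin n → ℤ)))

/-- `F` is a face of `P`: either the empty face or the set of minimizers of a
linear functional over `P`. -/
def IsFace {n : ℕ} (P F : Set (Fin n → ℝ)) : Prop :=
  F = ∅ ∨ ∃ c : Fin n → ℝ, F = argminSet c P

/-- The dimension of a set: the rank of the direction space of its affine span. -/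
def polyDim {n : ℕ} (P : Set (Fin n → ℝ)) : ℕ :=
  Module.finrank ℝ (affineSpan ℝ P).direction

/-- A point all of whose coordinates are integers. -/
def IsIntPt {m : ℕ} (x : Fin m → ℝ) : Prop := ∀ i, ∃ z : ℤ, x i = (z : ℝ)

/-- An affine chart identifying the affine hull of `P` with `ℝ^r` and mapping the induced
lattice of integral points bijectively onto `ℤ^r`. -/
def IsLatticeChart {n r : ℕ} (P : Set (Fin n → ℝ))
    (φ : (Fin n → ℝ) →ᵃ[ℝ] (Fin r → ℝ)) : Prop :=
  Set.BijOn (fun x => φ x) (affineSpan ℝ P : Set (Fin n → ℝ)) Set.univ ∧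
  ∀ x ∈ affineSpan ℝ P, (IsIntPt x ↔ IsIntPt (φ x))

open Classical in
/-- The normalized volume of a (rational) polytope `P`: `r!` times the Euclidean volume of
the image of `P` under a lattice-preserving affine chart of its affine hull (`r = dim P`).
This is well defined (independent of the chart) and integral for lattice polytopes. -/
def normVol {n : ℕ} (P : Set (Fin n → ℝ)) : ℝ :=
  (Nat.factorial (polyDim P)) *
    (if h : ∃ φ : (Fin n → ℝ) →ᵃ[ℝ] (Fin (polyDim P) → ℝ), IsLatticeChart P φ
      then (volume ((fun x => h.choose x) '' P)).toReal
      else 0)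

/-- The normalized volume is an even integer. -/
def EvenVol {n : ℕ} (P : Set (Fin n → ℝ)) : Prop := ∃ m : ℤ, normVol P = 2 * (m : ℝ)

/-- The class `Q_k`: lattice polytopes all of whose faces of dimension at least `2^k`
have even normalized volume. -/
def InQclass (k : ℕ) {n : ℕ} (P : Set (Fin n → ℝ)) : Prop :=
  IsLatticePolytope P ∧ ∀ F, IsFace P F → 2 ^ k ≤ polyDim F → EvenVol F

/-- The classes `P_k` of lattice polytopes dual to `k`-hidden-layer integral ReLU networks:
`P_0` consists of single lattice points, and `P_{k+1}` consists of finite Minkowski sums of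
convex hulls of unions of pairs of polytopes from `P_k`. -/
def InPclass {n : ℕ} : ℕ → Set (Fin n → ℝ) → Prop
  | 0, P => ∃ v : Fin n → ℤ, P = {fun i => ((v i : ℤ) : ℝ)}
  | k+1, P => ∃ (l : ℕ) (Q : Fin l → Set (Fin n → ℝ)), 0 < l ∧
      (∀ i, ∃ Q₁ Q₂ : Set (Fin n → ℝ), InPclass k Q₁ ∧ InPclass k Q₂ ∧
        Q i = convexHull ℝ (Q₁ ∪ Q₂)) ∧
      P = ∑ i, Q i

/-- A (polyhedral) subdivision of `R`: a finite collection of polytopes covering `R`,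
any two of which intersect in a common face. -/
def IsSubdivision {n : ℕ} (R : Set (Fin n → ℝ)) (𝒞 : Finset (Set (Fin n → ℝ))) : Prop :=
  (∀ C ∈ 𝒞, IsPolytope C) ∧
  (⋃ C ∈ 𝒞, C) = R ∧
  ∀ C ∈ 𝒞, ∀ D ∈ 𝒞, IsFace C (C ∩ D) ∧ IsFace D (C ∩ D)

/-- The standard simplex `Δ^n_0 = conv{0, e_1, …, e_n} ⊆ ℝ^n`. -/
def stdSimplexPoly (n : ℕ) : Set (Fin n → ℝ) :=
  convexHull ℝ ({0} ∪ Set.range (fun i : Fin n => fun j => if j = i then (1 : ℝ) else 0))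

theorem aux_int_add {n : ℕ} {x y : Fin n → ℝ} (hx : IsIntPt x) (hy : IsIntPt y) :
    IsIntPt (x + y) := by
  intro i
  obtain ⟨a, ha⟩ := hx i
  obtain ⟨b, hb⟩ := hy i
  exact ⟨a + b, by simp [ha, hb]⟩

theorem aux_int_sub {n : ℕ} {x y : Fin n → ℝ} (hx : IsIntPt x) (hy : IsIntPt y) :
    IsIntPt (x - y) := by
  intro i
  obtain ⟨a, ha⟩ := hx i
  obtain ⟨b, hb⟩ := hy i
  exact ⟨a - b, by simp [ha, hb]⟩

theorem aux_int_span {n : ℕ} (x : Fin n → ℝ) :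
    x ∈ Submodule.span ℤ (Set.range (Pi.basisFun ℝ (Fin n))) ↔ IsIntPt x := by
  rw [Module.Basis.mem_span_iff_repr_mem]
  constructor
  · intro h i
    obtain ⟨z, hz⟩ := h i
    exact ⟨z, by simpa using hz.symm⟩
  · intro h i
    obtain ⟨z, hz⟩ := h i
    exact ⟨z, by simpa using hz.symm⟩

theorem aux_basis {n : ℕ} (L : Submodule ℝ (Fin n → ℝ)) (S : Set (Fin n → ℝ))
    (hS : ∀ x ∈ S, IsIntPt x) (hL : Submodule.span ℝ S = L) :
    ∃ b : Module.Basis (Fin (Module.finrank ℝ L)) ℝ L,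
      ∀ x : L, IsIntPt (x : Fin n → ℝ) ↔ IsIntPt (b.equivFun x) := by
  let Z := Submodule.span ℤ (Set.range (Pi.basisFun ℝ (Fin n)))
  let Λ : Submodule ℤ L := ZLattice.comap ℝ Z L.subtype
  have hΛ : ∀ x : L, x ∈ Λ ↔ IsIntPt (x : Fin n → ℝ) := fun x => aux_int_span (x : Fin n → ℝ)
  have : DiscreteTopology Λ :=
    ZLattice.comap_discreteTopology ℝ Z (by exact continuous_subtype_val) L.injective_subtype
  have : IsZLattice ℝ Λ := by
    constructor
    rw [eq_top_iff]
    subst hL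
    refine (Submodule.span_span_coe_preimage (R := ℝ) (s := S)).symm.le.trans
      (Submodule.span_mono ?_)
    intro x hx
    exact (hΛ x).2 (hS _ hx)
  have : Module.Finite ℤ Λ := ZLattice.module_finite ℝ Λ
  have : Module.Free ℤ Λ := ZLattice.module_free ℝ Λ
  let b0 : Module.Basis (Fin (Module.finrank ℝ L)) ℤ Λ :=
    Module.finBasisOfFinrankEq ℤ Λ (ZLattice.rank ℝ Λ)
  refine ⟨b0.ofZLatticeBasis ℝ Λ, fun x => ?_⟩
  rw [← hΛ x]
  conv_lhs => rw [← b0.ofZLatticeBasis_span ℝ Λ]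
  rw [Module.Basis.mem_span_iff_repr_mem]
  constructor
  · intro h i
    obtain ⟨z, hz⟩ := h i
    exact ⟨z, by simpa using hz.symm⟩
  · intro h i
    obtain ⟨z, hz⟩ := h i
    exact ⟨z, by simpa using hz.symm⟩

theorem aux_chart_exists {n : ℕ} (P : Set (Fin n → ℝ)) (hP : IsLatticePolytope P) :
    ∃ φ : (Fin n → ℝ) →ᵃ[ℝ] (Fin (polyDim P) → ℝ), IsLatticeChart P φ := by
  obtain ⟨V, ⟨v0, hv0⟩, rfl⟩ := hP
  set W : Set (Fin n → ℝ) := (fun v (i : Fin n) => ((v i : ℤ) : ℝ)) '' (V : Set (Fin n → ℤ))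
    with hW
  let x0 : Fin n → ℝ := fun i => ((v0 i : ℤ) : ℝ)
  have hx0W : x0 ∈ W := ⟨v0, hv0, rfl⟩
  have hWint : ∀ x ∈ W, IsIntPt x := by
    rintro x ⟨v, -, rfl⟩ i
    exact ⟨v i, rfl⟩
  have hx0 : x0 ∈ affineSpan ℝ (convexHull ℝ W) := by
    rw [affineSpan_convexHull]; exact subset_affineSpan ℝ _ hx0W
  obtain ⟨b, hb⟩ := aux_basis (affineSpan ℝ (convexHull ℝ W)).direction (W -ᵥ W)
    (by
      rintro x ⟨a, ha, c, hc, rfl⟩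
      exact aux_int_sub (hWint a ha) (hWint c hc))
    (by rw [affineSpan_convexHull, direction_affineSpan]; rfl)
  obtain ⟨f, hf⟩ := LinearMap.exists_extend b.equivFun.toLinearMap
  have hf' : ∀ x : (affineSpan ℝ (convexHull ℝ W)).direction, f x = b.equivFun x := fun x =>
    LinearMap.congr_fun hf x
  have hmem : ∀ x ∈ affineSpan ℝ (convexHull ℝ W),
      x - x0 ∈ (affineSpan ℝ (convexHull ℝ W)).direction := fun x hx =>
    AffineSubspace.vsub_mem_direction hx hx0
  obtain ⟨φ, hφ⟩ : ∃ φ : (Fin n → ℝ) →ᵃ[ℝ]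
      (Fin (Module.finrank ℝ (affineSpan ℝ (convexHull ℝ W)).direction) → ℝ),
      ∀ x, φ x = f (x - x0) :=
    ⟨f.toAffineMap - AffineMap.const ℝ _ (f x0), fun x => by simp⟩
  unfold polyDim
  refine ⟨φ, ⟨?_, ?_, ?_⟩, ?_⟩
  · intro x _; trivial
  · intro x hx y hy hxy
    have h1 : f (x - x0) = f (y - x0) := by
      rw [← hφ, ← hφ]; exact hxy
    have h2 := hf' ⟨_, hmem x hx⟩
    have h3 := hf' ⟨_, hmem y hy⟩
    simp only at h2 h3
    rw [h1, h3] at h2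
    have := b.equivFun.injective h2
    have := congrArg Subtype.val this
    simpa using this.symm
  · intro y _
    refine ⟨(b.equivFun.symm y : _) + x0, ?_, ?_⟩
    · exact AffineSubspace.vadd_mem_of_mem_direction (b.equivFun.symm y).2 hx0
    · have := hf' (b.equivFun.symm y)
      simp only [hφ, add_sub_cancel_right, this, LinearEquiv.apply_symm_apply]
  · intro x hx
    have h2 := hf' ⟨_, hmem x hx⟩
    have h3 := hb ⟨_, hmem x hx⟩
    rw [← h2] at h3
    rw [hφ, ← h3]
    constructor
    · intro h; exact aux_int_sub h (hWint _ hx0W)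
    · intro h; simpa using aux_int_add h (hWint _ hx0W)

theorem aux_chart_inv {n r : ℕ} (P : Set (Fin n → ℝ)) (φ : (Fin n → ℝ) →ᵃ[ℝ] (Fin r → ℝ))
    (h : IsLatticeChart P φ) :
    ∃ ψ : (Fin r → ℝ) →ᵃ[ℝ] (Fin n → ℝ), (∀ y, ψ y ∈ affineSpan ℝ P) ∧
      (∀ y, IsIntPt y → IsIntPt (ψ y)) ∧ (∀ x ∈ affineSpan ℝ P, ψ (φ x) = x) := by
  obtain ⟨⟨_, hinj, hsurj⟩, hint⟩ := h
  obtain ⟨x0, hx0, -⟩ := hsurj (Set.mem_univ 0)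
  have hr : LinearMap.range (φ.linear ∘ₗ (affineSpan ℝ P).direction.subtype) = ⊤ := by
    rw [LinearMap.range_eq_top]
    intro y
    obtain ⟨x, hx, hxy⟩ := hsurj (Set.mem_univ (y + φ x0))
    refine ⟨⟨x -ᵥ x0, AffineSubspace.vsub_mem_direction hx hx0⟩, ?_⟩
    have : φ x = y + φ x0 := hxy
    rw [LinearMap.comp_apply, Submodule.subtype_apply, AffineMap.linearMap_vsub, this]
    simp
  obtain ⟨g, hg⟩ := LinearMap.exists_rightInverse_of_surjective _ hr
  let G : (Fin r → ℝ) →ₗ[ℝ] (Fin n → ℝ) := (affineSpan ℝ P).direction.subtype ∘ₗ g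
  let ψ : (Fin r → ℝ) →ᵃ[ℝ] (Fin n → ℝ) :=
    G.toAffineMap + AffineMap.const ℝ _ (x0 - G (φ x0))
  have hψ : ∀ y, ψ y = G (y - φ x0) +ᵥ x0 := by
    intro y; simp [ψ]; abel
  have hmem : ∀ y, ψ y ∈ affineSpan ℝ P := by
    intro y
    rw [hψ]
    exact AffineSubspace.vadd_mem_of_mem_direction (g _).2 hx0
  have hright : ∀ y, φ (ψ y) = y := by
    intro y
    rw [hψ, AffineMap.map_vadd]
    have := LinearMap.congr_fun hg (y - φ x0)
    have h2 : φ.linear (G (y - φ x0)) = y - φ x0 := this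
    rw [h2]; simp
  refine ⟨ψ, hmem, ?_, ?_⟩
  · intro y hy
    rw [hint _ (hmem y), hright]; exact hy
  · intro x hx
    exact hinj (hmem _) hx (hright _)

theorem aux_span_add {n : ℕ} (P Q : Set (Fin n → ℝ)) :
    (affineSpan ℝ (P + Q) : Set (Fin n → ℝ)) =
      (fun pq : (Fin n → ℝ) × (Fin n → ℝ) => pq.1 + pq.2) ''
      ((affineSpan ℝ P : Set (Fin n → ℝ)) ×ˢ (affineSpan ℝ Q : Set (Fin n → ℝ))) := by
  let s : ((Fin n → ℝ) × (Fin n → ℝ)) →ᵃ[ℝ] (Fin n → ℝ) :=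
    (LinearMap.fst ℝ _ _ + LinearMap.snd ℝ _ _ :
      ((Fin n → ℝ) × (Fin n → ℝ)) →ₗ[ℝ] (Fin n → ℝ)).toAffineMap
  have h1 : P + Q = s '' (P ×ˢ Q) := by
    rw [← Set.image2_add, ← Set.image_prod]; rfl
  rw [h1, ← AffineSubspace.map_span, AffineSubspace.coe_map, affineSpan_prod_eq]
  rfl

theorem aux_bij {n : ℕ} (P Q : Set (Fin n → ℝ)) (hP : P.Nonempty) (hQ : Q.Nonempty)
    (hdim : polyDim (P + Q) = polyDim P + polyDim Q) :
    Set.BijOn (fun pq : (Fin n → ℝ) × (Fin n → ℝ) => pq.1 + pq.2)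
      ((affineSpan ℝ P : Set (Fin n → ℝ)) ×ˢ (affineSpan ℝ Q : Set (Fin n → ℝ)))
      (affineSpan ℝ (P + Q) : Set (Fin n → ℝ)) := by
  rw [aux_span_add]
  refine Set.InjOn.bijOn_image ?_
  obtain ⟨p0, hp0⟩ := hP
  obtain ⟨q0, hq0⟩ := hQ
  have hle : (affineSpan ℝ (P + Q)).direction ≤
      (affineSpan ℝ P).direction ⊔ (affineSpan ℝ Q).direction := by
    rw [direction_affineSpan, vectorSpan_def, Submodule.span_le]
    rintro _ ⟨_, ⟨a, ha, b, hb, rfl⟩, _, ⟨c, hc, d, hd, rfl⟩, rfl⟩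
    have : (a + b) -ᵥ (c + d) = (a -ᵥ c) + (b -ᵥ d) := by
      simp only [vsub_eq_sub]; abel
    simp only
    rw [this]
    exact Submodule.add_mem_sup
      (AffineSubspace.vsub_mem_direction (subset_affineSpan ℝ _ ha) (subset_affineSpan ℝ _ hc))
      (AffineSubspace.vsub_mem_direction (subset_affineSpan ℝ _ hb) (subset_affineSpan ℝ _ hd))
  have h1 := Submodule.finrank_mono hle
  have h2 := Submodule.finrank_sup_add_finrank_inf_eq (affineSpan ℝ P).direction
    (affineSpan ℝ Q).direction
  unfold polyDim at hdim
  have h3 : Module.finrank ℝ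
    ((affineSpan ℝ P).direction ⊓ (affineSpan ℝ Q).direction : Submodule ℝ (Fin n → ℝ)) = 0 := by
    omega
  rw [Submodule.finrank_eq_zero] at h3
  rintro ⟨a, b⟩ ⟨ha, hb⟩ ⟨c, d⟩ ⟨hc, hd⟩ h
  simp only at ha hb hc hd h
  have h4 : a - c ∈ (affineSpan ℝ P).direction := AffineSubspace.vsub_mem_direction ha hc
  have h5 : d - b ∈ (affineSpan ℝ Q).direction := AffineSubspace.vsub_mem_direction hd hb
  have h6 : a - c = d - b := by
    rw [sub_eq_sub_iff_add_eq_add, h, add_comm]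
  have h7 : a - c ∈ (affineSpan ℝ P).direction ⊓ (affineSpan ℝ Q).direction :=
    ⟨h4, h6 ▸ h5⟩
  rw [h3, Submodule.mem_bot] at h7
  rw [h7] at h6
  rw [sub_eq_zero.1 h7, sub_eq_zero.1 h6.symm]

theorem aux_det_int {ι : Type*} [Fintype ι] [DecidableEq ι] (F : (ι → ℝ) →ₗ[ℝ] (ι → ℝ))
    (hF : ∀ j i, ∃ z : ℤ, F (Pi.single j 1) i = (z : ℝ)) :
    ∃ t : ℕ, |LinearMap.det F| = (t : ℝ) := by
  choose M hM using hF
  refine ⟨((Matrix.of fun i j => M j i).det).natAbs, ?_⟩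
  have : LinearMap.toMatrix' F = (Matrix.of fun i j => M j i).map (Int.castRingHom ℝ) := by
    ext i j
    simp [LinearMap.toMatrix'_apply, ← hM]
    try congr
  rw [← LinearMap.det_toMatrix', this, ← RingHom.mapMatrix_apply, ← RingHom.map_det]
  simp [Nat.cast_natAbs]

theorem aux_vol {i j m : ℕ} (hm : m = i + j)
    (A : ((Fin i → ℝ) × (Fin j → ℝ)) →ᵃ[ℝ] (Fin m → ℝ))
    (hA : ∀ x y, IsIntPt x → IsIntPt y → IsIntPt (A (x, y)))
    (S : Set (Fin i → ℝ)) (T : Set (Fin j → ℝ)) :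
    ∃ t : ℕ, (volume (A '' (S ×ˢ T))).toReal =
      t * ((volume S).toReal * (volume T).toReal) := by
  subst hm
  let e := MeasurableEquiv.sumPiEquivProdPi (fun _ : Fin i ⊕ Fin j => ℝ)
  have he := volume_measurePreserving_sumPiEquivProdPi (fun _ : Fin i ⊕ Fin j => ℝ)
  let k := MeasurableEquiv.piCongrLeft (fun _ : Fin (i + j) => ℝ) finSumFinEquiv
  have hk := volume_measurePreserving_piCongrLeft (fun _ : Fin (i + j) => ℝ)
    (finSumFinEquiv (m := i) (n := j))
  have hkapp : ∀ (w : Fin i ⊕ Fin j → ℝ) l, k w l = w (finSumFinEquiv.symm l) := by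
    intro w l
    obtain ⟨l, rfl⟩ := finSumFinEquiv.surjective l
    simp [k, MeasurableEquiv.coe_piCongrLeft, Equiv.piCongrLeft_apply_apply]
  let f0 : (Fin (i + j) → ℝ) →ₗ[ℝ] ((Fin i → ℝ) × (Fin j → ℝ)) :=
    { toFun := fun z => (fun a => z (Fin.castAdd j a), fun b => z (Fin.natAdd i b))
      map_add' := fun _ _ => rfl
      map_smul' := fun _ _ => rfl }
  let F := A.linear ∘ₗ f0
  have hvol : volume (f0 ⁻¹' (S ×ˢ T)) = volume S * volume T := by
    have h1 : f0 ⁻¹' (S ×ˢ T) = k.symm ⁻¹' (e ⁻¹' (S ×ˢ T)) := by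
      ext z
      obtain ⟨w, rfl⟩ := k.surjective z
      have : f0 (k w) = e (k.symm (k w)) := by
        rw [k.symm_apply_apply]
        refine Prod.ext ?_ ?_
        · ext a
          change k w (Fin.castAdd j a) = w (Sum.inl a)
          rw [hkapp]; simp
        · ext a
          change k w (Fin.natAdd i a) = w (Sum.inr a)
          rw [hkapp]; simp
      simp only [Set.mem_preimage, this]
    rw [h1, (hk.symm k).measure_preimage_equiv, he.measure_preimage_equiv,
      Measure.volume_eq_prod, Measure.prod_prod]
  have hf0 : Function.Surjective f0 := by
    rintro ⟨x, y⟩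
    exact ⟨Fin.append x y, by simp [f0]⟩
  have himg : A '' (S ×ˢ T) = (fun z => z + A 0) '' (F '' (f0 ⁻¹' (S ×ˢ T))) := by
    rw [Set.image_image]
    conv_lhs => rw [← Set.image_preimage_eq (S ×ˢ T) hf0]
    rw [Set.image_image]
    refine Set.image_congr fun z _ => ?_
    have := A.map_vadd 0 (f0 z)
    simpa [F] using this
  obtain ⟨t, ht⟩ := aux_det_int F (by
    intro l
    have h0 : IsIntPt (A 0) := hA 0 0 (fun _ => ⟨0, by simp⟩) (fun _ => ⟨0, by simp⟩)
    have hs : ∀ c, ∃ z : ℤ, (Pi.single l (1 : ℝ) : Fin (i + j) → ℝ) c = z := by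
      intro c
      by_cases h : c = l
      · exact ⟨1, by simp [h]⟩
      · exact ⟨0, by simp [h]⟩
    have h1 : IsIntPt (A (f0 (Pi.single l 1))) :=
      hA _ _ (fun a => hs _) (fun b => hs _)
    have h2 : F (Pi.single l 1) = A (f0 (Pi.single l 1)) - A 0 := by
      have := A.map_vadd 0 (f0 (Pi.single l 1))
      simp only [vadd_eq_add, add_zero] at this
      simp [F, this]
    rw [h2]
    exact aux_int_sub h1 h0)
  refine ⟨t, ?_⟩
  rw [himg, Set.image_add_right, measure_preimage_add_right, Measure.addHaar_image_linearMap,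
    hvol, ht]
  simp

/-- If `dim (P + Q) = dim P + dim Q` for lattice polytopes `P, Q`, then
`(p, q) ↦ p + q` is an affine bijection from `Aff(P) × Aff(Q)` onto `Aff(P+Q)` mapping
pairs of lattice points to lattice points, and `Vol(P+Q)` is a nonnegative integer
multiple of `Vol(P × Q) = binom(i+j, i) · Vol(P) · Vol(Q)`. -/
theorem minkowski_sum_affine_product_structure {n : ℕ} (P Q : Set (Fin n → ℝ))
    (hP : IsLatticePolytope P) (hQ : IsLatticePolytope Q)
    (hdim : polyDim (P + Q) = polyDim P + polyDim Q) :
    Set.BijOn (fun pq : (Fin n → ℝ) × (Fin n → ℝ) => pq.1 + pq.2)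
      ((affineSpan ℝ P : Set (Fin n → ℝ)) ×ˢ (affineSpan ℝ Q : Set (Fin n → ℝ)))
      (affineSpan ℝ (P + Q) : Set (Fin n → ℝ)) ∧
    (∀ p ∈ affineSpan ℝ P, ∀ q ∈ affineSpan ℝ Q,
      IsIntPt p → IsIntPt q → IsIntPt (p + q)) ∧
    ∃ t : ℕ, normVol (P + Q) =
      (t : ℝ) * ((Nat.choose (polyDim P + polyDim Q) (polyDim P) : ℝ) *
        normVol P * normVol Q) := by
  obtain ⟨VP, hVP⟩ := id hP
  obtain ⟨VQ, hVQ⟩ := id hQ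
  have hPne : P.Nonempty := by
    rw [hVP.2]; exact (Set.Nonempty.image _ (by exact_mod_cast hVP.1)).convexHull
  have hQne : Q.Nonempty := by
    rw [hVQ.2]; exact (Set.Nonempty.image _ (by exact_mod_cast hVQ.1)).convexHull
  refine ⟨aux_bij P Q hPne hQne hdim, fun p _ q _ h1 h2 => aux_int_add h1 h2, ?_⟩
  by_cases h : ∃ φ : (Fin n → ℝ) →ᵃ[ℝ] (Fin (polyDim (P + Q)) → ℝ), IsLatticeChart (P + Q) φ
  swap
  · exact ⟨0, by simp [normVol, dif_neg h]⟩
  have hp := aux_chart_exists P hP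
  have hq := aux_chart_exists Q hQ
  have e : normVol (P + Q) = (Nat.factorial (polyDim (P + Q))) *
      (volume ((fun x => h.choose x) '' (P + Q))).toReal := by
    rw [normVol, dif_pos h]
  have eP : normVol P = (Nat.factorial (polyDim P)) *
      (volume ((fun x => hp.choose x) '' P)).toReal := by
    rw [normVol, dif_pos hp]
  have eQ : normVol Q = (Nat.factorial (polyDim Q)) *
      (volume ((fun x => hq.choose x) '' Q)).toReal := by
    rw [normVol, dif_pos hq]
  have hφ := h.choose_spec
  have hφP := hp.choose_spec
  have hφQ := hq.choose_spec
  generalize h.choose = φ at e hφ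
  generalize hp.choose = φP at eP hφP
  generalize hq.choose = φQ at eQ hφQ
  obtain ⟨ψP, hP1, hP2, hP3⟩ := aux_chart_inv P φP hφP
  obtain ⟨ψQ, hQ1, hQ2, hQ3⟩ := aux_chart_inv Q φQ hφQ
  let A : ((Fin (polyDim P) → ℝ) × (Fin (polyDim Q) → ℝ)) →ᵃ[ℝ] (Fin (polyDim (P + Q)) → ℝ) :=
    φ.comp (ψP.comp AffineMap.fst + ψQ.comp AffineMap.snd)
  have hA : ∀ x y, A (x, y) = φ (ψP x + ψQ y) := fun x y => rfl
  obtain ⟨t, ht⟩ := aux_vol hdim A (by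
    intro x y hx hy
    rw [hA]
    refine (hφ.2 _ ?_).1 (aux_int_add (hP2 x hx) (hQ2 y hy))
    rw [← SetLike.mem_coe, aux_span_add]
    exact ⟨(_, _), ⟨hP1 x, hQ1 y⟩, rfl⟩) ((fun x => φP x) '' P) ((fun x => φQ x) '' Q)
  have himg : A '' (((fun x => φP x) '' P) ×ˢ ((fun x => φQ x) '' Q)) =
      (fun x => φ x) '' (P + Q) := by
    rw [Set.prod_image_image_eq, Set.image_image]
    have hs : ∀ p ∈ P, ∀ q ∈ Q, A (φP p, φQ q) = φ (p + q) := by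
      intro p h1 q h2
      rw [hA, hP3 p (subset_affineSpan ℝ _ h1), hQ3 q (subset_affineSpan ℝ _ h2)]
    ext z
    constructor
    · rintro ⟨⟨p, q⟩, ⟨h1, h2⟩, rfl⟩
      exact ⟨p + q, Set.add_mem_add h1 h2, (hs p h1 q h2).symm⟩
    · rintro ⟨_, ⟨p, h1, q, h2, rfl⟩, rfl⟩
      exact ⟨(p, q), ⟨h1, h2⟩, hs p h1 q h2⟩
  rw [himg] at ht
  refine ⟨t, ?_⟩
  rw [e, eP, eQ, ht, hdim, ← Nat.add_choose_mul_factorial_mul_factorial, ← Nat.choose_symm_add]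
  push_cast
  ring

end
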